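/- arXiv:2111.12199 — 3 statements merged into one kernel-verified Lean document; each statement's English description precedes it below -/
import Mathlib

section
/- If {M_1,…,M_r} and {N_1,…,N_s} are two fillings of a simplicial complex K on the vertex set [m] (each filling being a set of pairwise distinct minimal non-faces of K whose addition to K has contractible geometric realization), then r = s. -/
/-- The `i`-th standard basis vector of `ℝ^m`. -/
def stdBasisVec (m : ℕ) (i : Fin m) : Fin m → ℝ := fun j => if j = i then 1 else 0

/-- The geometric realization of a collection of finite subsets of `[m]`:
the union of the convex hulls of the corresponding sets of standard basis vectors. -/
def realization {m : ℕ} (K : Set (Finset (Fin m))) : Set (Fin m → ℝ) :=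
  ⋃ σ ∈ K, convexHull ℝ (stdBasisVec m '' (σ : Set (Fin m)))

/-- `K` is an (abstract) simplicial complex on the vertex set `[m]`: a collection of
nonempty subsets closed under passing to nonempty subsets and containing all singletons. -/
def IsComplex {m : ℕ} (K : Set (Finset (Fin m))) : Prop :=
  (∀ σ ∈ K, σ.Nonempty) ∧
  (∀ σ ∈ K, ∀ τ : Finset (Fin m), τ ⊆ σ → τ.Nonempty → τ ∈ K) ∧
  (∀ i : Fin m, {i} ∈ K)

/-- `M` is a minimal non-face of `K`. -/
def IsMinNonFace {m : ℕ} (K : Set (Finset (Fin m))) (M : Finset (Fin m)) : Prop :=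
  2 ≤ M.card ∧ M ∉ K ∧ ∀ v ∈ M, M.erase v ∈ K

/-- A finite set `F` of (pairwise distinct) minimal non-faces of `K` is a filling
if the realization of `K` with the members of `F` added as faces is contractible. -/
def IsFilling {m : ℕ} (K : Set (Finset (Fin m))) (F : Finset (Finset (Fin m))) : Prop :=
  (∀ M ∈ F, IsMinNonFace K M) ∧
  ContractibleSpace (realization (K ∪ ↑F))

/-! ### Augmented ordered chains, with lists of points as generators -/

/-- Augmented ordered chains with coefficients in `ZMod 2` on the vertex type `E`. -/
abbrev OrdChain (E : Type*) : Type _ := List E →₀ ZMod 2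

namespace OrdChain

variable {E E' : Type*}

/-- The cone operator, prepending the vertex `a`. -/
noncomputable def cone (a : E) : OrdChain E →ₗ[ZMod 2] OrdChain E :=
  Finsupp.lmapDomain _ _ (List.cons a)

/-- The boundary of an ordered simplex. -/
noncomputable def bdList : List E → OrdChain E
  | [] => 0
  | a :: l => Finsupp.single l 1 - cone a (bdList l)

/-- The boundary operator on ordered chains. -/
noncomputable def bd : OrdChain E →ₗ[ZMod 2] OrdChain E :=
  Finsupp.linearCombination _ bdList

/-- The map on chains induced by a map of vertices. -/
noncomputable def map (f : E → E') : OrdChain E →ₗ[ZMod 2] OrdChain E' :=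
  Finsupp.lmapDomain _ _ (List.map f)

/-- The prism over an ordered simplex, interpolating between `f` and `g`. -/
noncomputable def prismList (f g : E → E') : List E → OrdChain E'
  | [] => 0
  | a :: l => Finsupp.single (f a :: g a :: l.map g) 1 - cone (f a) (prismList f g l)

/-- The prism operator, a chain homotopy from `map f` to `map g`. -/
noncomputable def prism (f g : E → E') : OrdChain E →ₗ[ZMod 2] OrdChain E' :=
  Finsupp.linearCombination _ (prismList f g)

@[simp] lemma cone_single (a : E) (l : List E) (r : ZMod 2) :
    cone a (Finsupp.single l r) = Finsupp.single (a :: l) r := by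
  simp [cone, Finsupp.mapDomain_single]

@[simp] lemma map_single (f : E → E') (l : List E) (r : ZMod 2) :
    map f (Finsupp.single l r) = Finsupp.single (l.map f) r := by
  simp [map, Finsupp.mapDomain_single]

@[simp] lemma bd_single (l : List E) : bd (Finsupp.single l 1) = bdList l := by
  simp [bd]

@[simp] lemma prism_single (f g : E → E') (l : List E) :
    prism f g (Finsupp.single l 1) = prismList f g l := by
  simp [prism]

lemma bd_cone (a : E) (c : OrdChain E) : bd (cone a c) = c - cone a (bd c) := by
  have h : bd ∘ₗ cone a = LinearMap.id - cone a ∘ₗ bd := by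
    ext1 l
    ext1
    simp [bdList]
  exact LinearMap.congr_fun h c

lemma map_cone (f : E → E') (a : E) (c : OrdChain E) :
    map f (cone a c) = cone (f a) (map f c) := by
  have h : map f ∘ₗ cone a = cone (f a) ∘ₗ map f := by
    ext1 l
    ext1
    simp
  exact LinearMap.congr_fun h c

lemma prism_cone (f g : E → E') (a : E) (c : OrdChain E) :
    prism f g (cone a c) = cone (f a) (cone (g a) (map g c)) - cone (f a) (prism f g c) := by
  have h : prism f g ∘ₗ cone a =
      cone (f a) ∘ₗ cone (g a) ∘ₗ map g - cone (f a) ∘ₗ prism f g := by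
    ext1 l
    ext1
    simp [prismList]
  exact LinearMap.congr_fun h c

lemma bd_map (f : E → E') (c : OrdChain E) : bd (map f c) = map f (bd c) := by
  have h : bd ∘ₗ map f = map f ∘ₗ bd := by
    ext1 l
    ext1
    simp only [LinearMap.comp_apply, Finsupp.lsingle_apply, map_single, bd_single]
    induction l with
    | nil => simp [bdList]
    | cons a l ih => simp [bdList, map_cone, ih]
  exact LinearMap.congr_fun h c

lemma bd_prism_add_prism_bd (f g : E → E') (c : OrdChain E) :
    bd (prism f g c) + prism f g (bd c) = map g c - map f c := by
  have h : bd ∘ₗ prism f g + prism f g ∘ₗ bd = map g - map f := by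
    ext1 l
    ext1
    simp only [LinearMap.comp_apply, Finsupp.lsingle_apply, LinearMap.add_apply,
      LinearMap.sub_apply, map_single, bd_single, prism_single]
    induction l with
    | nil => simp [bdList, prismList]
    | cons a l ih =>
      have ih' := eq_sub_of_add_eq ih
      have hm : bdList (l.map g) = map g (bdList l) := by
        simpa using bd_map g (Finsupp.single l 1)
      simp only [prismList, bdList, map_sub, bd_single, bd_cone, ih', prism_single, prism_cone,
        cone_single, List.map_cons, hm]
      abel
  exact LinearMap.congr_fun h c

/-- A linear map sends chains supported on `s` into `N` as soon as it does so for generators. -/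
lemma _root_.Finsupp.linearMap_mem_of_mem_supported {α M : Type*} [AddCommGroup M]
    [Module (ZMod 2) M] (T : (α →₀ ZMod 2) →ₗ[ZMod 2] M) (N : Submodule (ZMod 2) M) {s : Set α}
    (h : ∀ l ∈ s, T (Finsupp.single l 1) ∈ N) {c : α →₀ ZMod 2}
    (hc : c ∈ Finsupp.supported (ZMod 2) (ZMod 2) s) : T c ∈ N := by
  rw [Finsupp.supported_eq_span_single] at hc
  have : Submodule.span (ZMod 2) ((fun i => Finsupp.single i (1 : ZMod 2)) '' s) ≤ N.comap T := by
    rw [Submodule.span_le]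
    rintro _ ⟨l, hl, rfl⟩
    exact h l hl
  exact this hc

/-- The chains all of whose simplices have their vertices in `Y` at mutual distance `< ε`. -/
noncomputable def small [PseudoMetricSpace E] (ε : ℝ) (Y : Set E) :
    Submodule (ZMod 2) (OrdChain E) :=
  Finsupp.supported _ _ {l | (∀ x ∈ l, x ∈ Y) ∧ ∀ x ∈ l, ∀ y ∈ l, dist x y < ε}

lemma small_mono [PseudoMetricSpace E] (ε : ℝ) {Y Z : Set E} (h : Y ⊆ Z) :
    small ε Y ≤ small ε Z :=
  Finsupp.supported_mono fun _ hl => ⟨fun x hx => h (hl.1 x hx), hl.2⟩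

lemma prismList_mem_supported (f g : E → E') (l : List E) :
    prismList f g l ∈ Finsupp.supported (ZMod 2) (ZMod 2)
      {l' | ∀ y ∈ l', ∃ x ∈ l, y = f x ∨ y = g x} := by
  induction l with
  | nil => simp [prismList]
  | cons a l ih =>
    refine Submodule.sub_mem _ (Finsupp.single_mem_supported _ _ ?_) ?_
    · intro y hy
      simp only [List.mem_cons, List.mem_map] at hy
      rcases hy with rfl | rfl | ⟨x, hx, rfl⟩
      · exact ⟨a, by simp, .inl rfl⟩
      · exact ⟨a, by simp, .inr rfl⟩
      · exact ⟨x, by simp [hx], .inr rfl⟩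
    · refine Finsupp.linearMap_mem_of_mem_supported _ _ (fun l' hl' => ?_) ih
      rw [cone_single]
      refine Finsupp.single_mem_supported _ _ fun y hy => ?_
      rcases List.mem_cons.1 hy with rfl | hy
      · exact ⟨a, by simp, .inl rfl⟩
      · obtain ⟨x, hx, h⟩ := hl' y hy
        exact ⟨x, by simp [hx], h⟩

/-- A cycle is the boundary of a small chain if its vertices can be moved to a single point in
steps which are small on each simplex of the cycle. -/
lemma exists_bd_eq_of_contraction [PseudoMetricSpace E] {ε : ℝ} (hε : 0 < ε) {Y : Set E}
    (f : ℕ → E → E) (N : ℕ) (c : E) (hc : c ∈ Y) (z : OrdChain E) (hz : bd z = 0)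
    (hmem : ∀ l ∈ z.support, ∀ x ∈ l, ∀ i ≤ N, f i x ∈ Y)
    (hdist : ∀ l ∈ z.support, ∀ x ∈ l, ∀ y ∈ l, ∀ i < N,
      dist (f i x) (f i y) < ε ∧ dist (f i x) (f (i + 1) y) < ε ∧
        dist (f (i + 1) x) (f (i + 1) y) < ε)
    (h0 : ∀ l ∈ z.support, ∀ x ∈ l, f 0 x = x)
    (hN : ∀ l ∈ z.support, ∀ x ∈ l, f N x = c) :
    ∃ b ∈ small ε Y, bd b = z := by
  have hzs : z ∈ Finsupp.supported (ZMod 2) (ZMod 2) (z.support : Set (List E)) :=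
    Finsupp.mem_supported_support _ z
  have hmap0 : map (f 0) z = z := by
    have : map (f 0) z = Finsupp.mapDomain id z := by
      refine Finsupp.mapDomain_congr fun l hl => ?_
      conv_rhs => rw [id, ← List.map_id l]
      exact List.map_congr_left fun x hx => h0 l hl x hx
    rw [this, Finsupp.mapDomain_id]
  refine ⟨cone c (map (f N) z) - ∑ i ∈ Finset.range N, prism (f i) (f (i + 1)) z,
    Submodule.sub_mem _ ?_ (Submodule.sum_mem _ fun i hi => ?_), ?_⟩
  · refine Finsupp.linearMap_mem_of_mem_supported (cone c ∘ₗ map (f N)) _ (fun l hl => ?_) hzs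
    rw [LinearMap.comp_apply, map_single, cone_single]
    have hall : ∀ x ∈ c :: l.map (f N), x = c := by
      intro x hx
      simp only [List.mem_cons, List.mem_map] at hx
      rcases hx with rfl | ⟨y, hy, rfl⟩
      · rfl
      · exact hN l hl y hy
    refine Finsupp.single_mem_supported _ _ ⟨fun x hx => hall x hx ▸ hc, fun x hx y hy => ?_⟩
    rw [hall x hx, hall y hy, dist_self]
    exact hε
  · have hi := Finset.mem_range.1 hi
    refine Finsupp.linearMap_mem_of_mem_supported _ _ (fun l hl => ?_) hzs
    rw [prism_single]
    refine (Finsupp.mem_supported _ _).2 fun l' hl' => ?_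
    replace hl' := (Finsupp.mem_supported _ _).1 (prismList_mem_supported _ _ l) hl'
    refine ⟨fun x hx => ?_, fun x hx y hy => ?_⟩
    · obtain ⟨u, hu, rfl | rfl⟩ := hl' x hx
      · exact hmem l hl u hu i hi.le
      · exact hmem l hl u hu (i + 1) hi
    · obtain ⟨u, hu, hu'⟩ := hl' x hx
      obtain ⟨v, hv, hv'⟩ := hl' y hy
      have h1 := hdist l hl u hu v hv i hi
      have h2 := (hdist l hl v hv u hu i hi).2.1
      rw [dist_comm] at h2
      rcases hu' with rfl | rfl <;> rcases hv' with rfl | rfl <;> simp [*]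
  · have hp : ∀ i, bd (prism (f i) (f (i + 1)) z) = map (f (i + 1)) z - map (f i) z := by
      intro i
      simpa [hz] using bd_prism_add_prism_bd (f i) (f (i + 1)) z
    rw [map_sub, map_sum, Finset.sum_congr rfl fun i _ => hp i,
      Finset.sum_range_sub (fun i => map (f i) z), bd_cone, bd_map, hz, hmap0]
    simp

/-- Small chains on a bounded convex set are acyclic. -/
lemma exists_bd_eq_of_convex {V : Type*} [NormedAddCommGroup V] [NormedSpace ℝ V] {ε : ℝ}
    (hε : 0 < ε) {Y : Set V} (hY : Convex ℝ Y) (hb : Bornology.IsBounded Y) (hne : Y.Nonempty)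
    (z : OrdChain V) (hzY : z ∈ small ε Y) (hz : bd z = 0) : ∃ b ∈ small ε Y, bd b = z := by
  obtain ⟨c, hc⟩ := hne
  obtain ⟨R, hR⟩ := (Metric.isBounded_iff_subset_closedBall c).1 hb
  have hzl : ∀ l ∈ z.support, (∀ x ∈ l, x ∈ Y) ∧ ∀ x ∈ l, ∀ y ∈ l, dist x y < ε :=
    fun l hl => (Finsupp.mem_supported _ _).1 hzY hl
  have hev : ∀ᶠ N : ℕ in Filter.atTop, ∀ l ∈ (z.support : Set (List V)), ∀ x ∈ {x | x ∈ l},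
      ∀ y ∈ {x | x ∈ l}, dist x y + R / N < ε := by
    rw [Filter.eventually_all_finite z.support.finite_toSet]
    intro l hl
    rw [Filter.eventually_all_finite l.finite_toSet]
    intro x hx
    rw [Filter.eventually_all_finite l.finite_toSet]
    intro y hy
    have ht : Filter.Tendsto (fun N : ℕ => dist x y + R / N) Filter.atTop
        (nhds (dist x y + 0)) :=
      tendsto_const_nhds.add (tendsto_const_div_atTop_nhds_zero_nat R)
    rw [add_zero] at ht
    exact ht.eventually_lt_const ((hzl l hl).2 x hx y hy)
  obtain ⟨N, hN, hN0⟩ := (hev.and (Filter.eventually_gt_atTop 0)).exists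
  have hN0' : (0 : ℝ) < N := by exact_mod_cast hN0
  refine exists_bd_eq_of_contraction hε
    (fun i x => (1 - (i / N : ℝ)) • x + (i / N : ℝ) • c) N c hc z hz ?_ ?_ ?_ ?_
  · intro l hl x hx i hi
    have hi' : (i : ℝ) ≤ N := by exact_mod_cast hi
    exact hY ((hzl l hl).1 x hx) hc (sub_nonneg.2 ((div_le_one hN0').2 hi')) (by positivity)
      (by ring)
  · intro l hl x hx y hy i hi
    have hxy := hN l hl x hx y hy
    have hR0 : 0 ≤ R := dist_nonneg.trans (Metric.mem_closedBall.1 (hR ((hzl l hl).1 x hx)))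
    have hyc : ‖y - c‖ ≤ R := by
      simpa [dist_eq_norm] using hR ((hzl l hl).1 y hy)
    have hdist : dist x y < ε := by
      have : 0 ≤ R / N := by positivity
      linarith
    have key : ∀ j : ℕ, j ≤ N →
        dist ((1 - (j / N : ℝ)) • x + (j / N : ℝ) • c) ((1 - (j / N : ℝ)) • y + (j / N : ℝ) • c)
          ≤ dist x y := by
      intro j hj
      have hj' : (j : ℝ) ≤ N := by exact_mod_cast hj
      have h1 : 0 ≤ 1 - (j / N : ℝ) := sub_nonneg.2 ((div_le_one hN0').2 hj')
      have h2 : 1 - (j / N : ℝ) ≤ 1 := by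
        have : 0 ≤ (j / N : ℝ) := by positivity
        linarith
      rw [dist_add_right, dist_smul₀, Real.norm_of_nonneg h1]
      exact mul_le_of_le_one_left dist_nonneg h2
    refine ⟨(key i hi.le).trans_lt hdist, ?_, (key (i + 1) hi).trans_lt hdist⟩
    refine (dist_triangle _ _ _).trans_lt ((add_le_add (key i hi.le) ?_).trans_lt hxy)
    rw [dist_eq_norm]
    have : (1 - (i / N : ℝ)) • y + (i / N : ℝ) • c -
        ((1 - ((i + 1 : ℕ) / N : ℝ)) • y + ((i + 1 : ℕ) / N : ℝ) • c) =
        (1 / N : ℝ) • (y - c) := by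
      push_cast
      module
    rw [this, norm_smul, Real.norm_of_nonneg (by positivity), one_div, div_eq_inv_mul]
    gcongr
  · intro l hl x hx
    simp
  · intro l hl x hx
    simp [hN0'.ne']

end OrdChain

/-! ### Augmented simplicial chains, with finite sets of vertices as generators -/

/-- Augmented simplicial chains with coefficients in `ZMod 2` on the vertex type `α`. -/
abbrev FaceChain (α : Type*) : Type _ := Finset α →₀ ZMod 2

namespace FaceChain

variable {α : Type*} [DecidableEq α]

/-- The boundary operator on simplicial chains. -/
noncomputable def bd : FaceChain α →ₗ[ZMod 2] FaceChain α :=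
  Finsupp.linearCombination _ fun σ => ∑ v ∈ σ, Finsupp.single (σ.erase v) 1

/-- Joining with the vertex `a`. -/
noncomputable def wedge (a : α) : FaceChain α →ₗ[ZMod 2] FaceChain α :=
  Finsupp.linearCombination _ fun σ => if a ∈ σ then 0 else Finsupp.single (insert a σ) 1

lemma bd_single (σ : Finset α) :
    bd (Finsupp.single σ 1) = ∑ v ∈ σ, Finsupp.single (σ.erase v) (1 : ZMod 2) := by
  simp [bd]

lemma wedge_single (a : α) (σ : Finset α) :
    wedge a (Finsupp.single σ 1) = if a ∈ σ then 0 else Finsupp.single (insert a σ) 1 := by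
  simp [wedge]

lemma bd_wedge (a : α) (c : FaceChain α) : bd (wedge a c) = c - wedge a (bd c) := by
  have h : bd ∘ₗ wedge a = LinearMap.id - wedge a ∘ₗ bd := by
    ext1 σ
    ext1
    simp only [LinearMap.comp_apply, Finsupp.lsingle_apply, LinearMap.sub_apply, LinearMap.id_apply,
      bd_single, wedge_single, map_sum]
    by_cases ha : a ∈ σ
    · rw [if_pos ha, map_zero, Finset.sum_eq_single_of_mem a ha]
      · simp [Finset.insert_erase ha]
      · intro v _ hv
        simp [ha, hv.symm]
    · rw [if_neg ha, bd_single, Finset.sum_insert ha, Finset.erase_insert ha,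
        ZModModule.sub_eq_add]
      congr 1
      refine Finset.sum_congr rfl fun v hv => ?_
      have hva : v ≠ a := fun h => ha (h ▸ hv)
      rw [if_neg fun h => ha (Finset.mem_of_mem_erase h), Finset.erase_insert_of_ne hva.symm]
  exact LinearMap.congr_fun h c

lemma bd_bd (c : FaceChain α) : bd (bd c) = 0 := by
  have h : bd ∘ₗ bd = (0 : FaceChain α →ₗ[ZMod 2] FaceChain α) := by
    ext1 σ
    ext1
    simp only [LinearMap.comp_apply, Finsupp.lsingle_apply, LinearMap.zero_apply]
    induction σ using Finset.induction_on with
    | empty => simp [bd_single]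
    | insert a σ ha ih =>
      have hw : Finsupp.single (insert a σ) (1 : ZMod 2) = wedge a (Finsupp.single σ 1) := by
        rw [wedge_single, if_neg ha]
      rw [hw, bd_wedge, map_sub, bd_wedge, ih, map_zero, sub_zero, sub_self]
  exact LinearMap.congr_fun h c

/-- The chains spanned by the simplices in `L`, together with the empty simplex. -/
noncomputable def chains (L : Set (Finset α)) : Submodule (ZMod 2) (FaceChain α) :=
  Finsupp.supported _ _ (insert ∅ L)

/-- The coefficient at a codimension one face of the boundary of a chain on the simplex `σ`. -/
lemma bd_apply_erase {σ : Finset α} {v : α} (hv : v ∈ σ) {c : FaceChain α}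
    (hc : c ∈ Finsupp.supported (ZMod 2) (ZMod 2) {τ | τ ⊆ σ}) : bd c (σ.erase v) = c σ := by
  have h := Finsupp.linearMap_mem_of_mem_supported
    (Finsupp.lapply (σ.erase v) ∘ₗ bd - Finsupp.lapply σ) ⊥ (s := {τ | τ ⊆ σ}) (c := c) ?_ hc
  · rw [Submodule.mem_bot, LinearMap.sub_apply, sub_eq_zero] at h
    exact h
  · intro τ hτ
    have hτ : τ ⊆ σ := hτ
    simp only [Submodule.mem_bot, LinearMap.sub_apply, LinearMap.comp_apply, Finsupp.lapply_apply,
      bd_single, Finsupp.finsetSum_apply, sub_eq_zero]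
    by_cases hτσ : τ = σ
    · subst hτσ
      rw [Finset.sum_eq_single_of_mem v hv]
      · simp
      · intro w hw hwv
        rw [Finsupp.single_apply_eq_zero]
        intro h
        have : v ∈ τ.erase v := h ▸ Finset.mem_erase.2 ⟨hwv.symm, hv⟩
        simp at this
    · rw [Finsupp.single_eq_of_ne (Ne.symm hτσ)]
      refine Finset.sum_eq_zero fun w hw => ?_
      rw [Finsupp.single_apply_eq_zero]
      intro h
      refine absurd (Finset.eq_of_subset_of_card_le hτ ?_) hτσ
      have h1 := Finset.card_erase_add_one hw
      have h2 := Finset.card_erase_add_one hv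
      rw [h] at h2
      omega

/-- A chain map carried by the simplices which fixes the empty simplex is unipotent. -/
lemma apply_single_self_eq_one (T : FaceChain α →ₗ[ZMod 2] FaceChain α)
    (hT : ∀ c, bd (T c) = T (bd c)) (hT0 : T (Finsupp.single ∅ 1) = Finsupp.single ∅ 1)
    (hc : ∀ σ, T (Finsupp.single σ 1) ∈ Finsupp.supported (ZMod 2) (ZMod 2) {τ | τ ⊆ σ})
    (σ : Finset α) : T (Finsupp.single σ 1) σ = 1 := by
  induction σ using Finset.strongInduction with
  | H σ ih =>
    rcases σ.eq_empty_or_nonempty with rfl | ⟨v, hv⟩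
    · simp [hT0]
    · rw [← bd_apply_erase hv (hc σ), hT, bd_single, map_sum, Finsupp.finsetSum_apply,
        Finset.sum_eq_single_of_mem v hv]
      · exact ih _ (Finset.erase_ssubset hv)
      · intro w hw hwv
        by_contra hne
        have : σ.erase v ⊆ σ.erase w :=
          (Finsupp.mem_supported _ _).1 (hc (σ.erase w)) (Finsupp.mem_support_iff.2 hne)
        have := this (Finset.mem_erase.2 ⟨hwv, hw⟩)
        simp at this

/-- A chain map carried by the simplices which fixes the empty simplex is injective. -/
lemma injective_of_carried (T : FaceChain α →ₗ[ZMod 2] FaceChain α)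
    (hT : ∀ c, bd (T c) = T (bd c)) (hT0 : T (Finsupp.single ∅ 1) = Finsupp.single ∅ 1)
    (hc : ∀ σ, T (Finsupp.single σ 1) ∈ Finsupp.supported (ZMod 2) (ZMod 2) {τ | τ ⊆ σ}) :
    Function.Injective T := by
  rw [injective_iff_map_eq_zero]
  intro c h
  by_contra hne
  obtain ⟨σ, hσ, hmax⟩ :=
    c.support.exists_max_image Finset.card (Finsupp.support_nonempty_iff.2 hne)
  have hsum : T c σ = ∑ τ ∈ c.support, c τ * T (Finsupp.single τ 1) σ := by
    conv_lhs => rw [← c.sum_single]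
    rw [Finsupp.sum, map_sum, Finsupp.finsetSum_apply]
    refine Finset.sum_congr rfl fun τ _ => ?_
    rw [← mul_one (c τ), ← smul_eq_mul, ← Finsupp.smul_single, map_smul]
    simp
  rw [h, Finset.sum_eq_single_of_mem σ hσ, apply_single_self_eq_one T hT hT0 hc, mul_one] at hsum
  · exact Finsupp.mem_support_iff.1 hσ hsum.symm
  · intro τ hτ hτσ
    have : T (Finsupp.single τ 1) σ = 0 := by
      by_contra hne
      have hsub : σ ⊆ τ :=
        (Finsupp.mem_supported _ _).1 (hc τ) (Finsupp.mem_support_iff.2 hne)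
      exact hτσ (Finset.eq_of_subset_of_card_le hsub (hmax τ hτ)).symm
    rw [this, mul_zero]

/-- If a chain map carried by the simplices and fixing the empty simplex sends a cycle of a
finite complex to a boundary, then the cycle is itself a boundary. -/
lemma exists_bd_eq_of_carried [Finite α] {L : Set (Finset α)}
    (hL : ∀ σ ∈ insert ∅ L, ∀ τ ⊆ σ, τ ∈ insert ∅ L) (T : FaceChain α →ₗ[ZMod 2] FaceChain α)
    (hT : ∀ c, bd (T c) = T (bd c)) (hT0 : T (Finsupp.single ∅ 1) = Finsupp.single ∅ 1)
    (hc : ∀ σ, T (Finsupp.single σ 1) ∈ Finsupp.supported (ZMod 2) (ZMod 2) {τ | τ ⊆ σ})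
    {z : FaceChain α} (hz : ∃ b ∈ chains L, bd b = T z) : ∃ b ∈ chains L, bd b = z := by
  have hinj := injective_of_carried T hT hT0 hc
  have hmaps : ∀ c ∈ chains L, T c ∈ chains L := fun c hcL =>
    Finsupp.linearMap_mem_of_mem_supported T _
      (fun σ hσ => Finsupp.supported_mono (fun τ hτ => hL σ hσ τ hτ) (hc σ)) hcL
  have hinj' : Function.Injective (T.restrict hmaps) := fun x y hxy =>
    Subtype.ext (hinj (congrArg Subtype.val hxy))
  have hsurj : Function.Surjective (T.restrict hmaps) :=
    (LinearMap.injective_iff_surjective (K := ZMod 2) (V := chains L)).1 hinj'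
  obtain ⟨b, hb, hbz⟩ := hz
  obtain ⟨⟨b', hb'⟩, h⟩ := hsurj ⟨b, hb⟩
  refine ⟨b', hb', hinj ?_⟩
  have h' : T b' = b := congrArg Subtype.val h
  rw [← hT, h', hbz]

/-- The simplicial chain of an ordered simplex, zero if a vertex is repeated. -/
noncomputable def ofList : List α → FaceChain α
  | [] => Finsupp.single ∅ 1
  | a :: l => wedge a (ofList l)

/-- The projection from ordered chains to simplicial chains. -/
noncomputable def ofOrd : OrdChain α →ₗ[ZMod 2] FaceChain α :=
  Finsupp.linearCombination _ ofList

@[simp] lemma ofOrd_single (l : List α) : ofOrd (Finsupp.single l 1) = ofList l := by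
  simp [ofOrd]

lemma ofOrd_cone (a : α) (c : OrdChain α) : ofOrd (OrdChain.cone a c) = wedge a (ofOrd c) := by
  have h : ofOrd ∘ₗ OrdChain.cone a = wedge a ∘ₗ ofOrd := by
    ext1 l
    ext1
    simp [ofList]
  exact LinearMap.congr_fun h c

lemma bd_ofOrd (c : OrdChain α) : bd (ofOrd c) = ofOrd (OrdChain.bd c) := by
  have h : bd ∘ₗ ofOrd = ofOrd ∘ₗ (OrdChain.bd (E := α)) := by
    ext1 l
    ext1
    simp only [LinearMap.comp_apply, Finsupp.lsingle_apply, ofOrd_single, OrdChain.bd_single]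
    induction l with
    | nil => simp [ofList, OrdChain.bdList, bd_single]
    | cons a l ih => simp [ofList, OrdChain.bdList, bd_wedge, ih, ofOrd_cone]
  exact LinearMap.congr_fun h c

lemma ofList_mem_supported (l : List α) :
    ofList l ∈ Finsupp.supported (ZMod 2) (ZMod 2) {l.toFinset} := by
  induction l with
  | nil => exact Finsupp.single_mem_supported _ _ rfl
  | cons a l ih =>
    refine Finsupp.linearMap_mem_of_mem_supported (wedge a) _ (fun σ hσ => ?_) ih
    rw [Set.mem_singleton_iff] at hσ
    rw [wedge_single]
    split_ifs
    · exact Submodule.zero_mem _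
    · refine Finsupp.single_mem_supported _ _ ?_
      rw [hσ, List.toFinset_cons]
      rfl

end FaceChain

/-! ### Comparison of the geometric realization with the simplicial chains -/

section Realization

variable {m : ℕ}

/-- The geometric simplex spanned by `σ`. -/
def geomSimplex (σ : Finset (Fin m)) : Set (Fin m → ℝ) :=
  convexHull ℝ (stdBasisVec m '' (σ : Set (Fin m)))

lemma geomSimplex_mono {σ τ : Finset (Fin m)} (h : σ ⊆ τ) : geomSimplex σ ⊆ geomSimplex τ :=
  convexHull_mono (Set.image_mono (Finset.coe_subset.2 h))

lemma geomSimplex_subset_realization {L : Set (Finset (Fin m))} {σ : Finset (Fin m)}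
    (h : σ ∈ L) : geomSimplex σ ⊆ realization L :=
  Set.subset_biUnion_of_mem (u := fun σ => geomSimplex σ) h

lemma mem_geomSimplex {σ : Finset (Fin m)} {x : Fin m → ℝ} (hx : x ∈ geomSimplex σ) :
    (∀ i ∉ σ, x i = 0) ∧ ∑ i, x i = 1 := by
  have hsub : geomSimplex σ ⊆ {x | (∀ i ∉ σ, x i = 0) ∧ ∑ i, x i = 1} := by
    refine convexHull_min ?_ ?_
    · rintro _ ⟨i, hi, rfl⟩
      refine ⟨fun j hj => if_neg ?_, ?_⟩
      · rintro rfl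
        exact hj hi
      · simp [stdBasisVec]
    · intro x hx y hy a b _ _ hab
      refine ⟨fun i hi => ?_, ?_⟩
      · simp [hx.1 i hi, hy.1 i hi]
      · simp [Finset.sum_add_distrib, ← Finset.mul_sum, hx.2, hy.2, hab]
  exact hsub hx

lemma isCompact_geomSimplex (σ : Finset (Fin m)) : IsCompact (geomSimplex σ) :=
  (σ.finite_toSet.image _).isCompact_convexHull ℝ

lemma isCompact_realization (L : Set (Finset (Fin m))) : IsCompact (realization L) :=
  L.toFinite.isCompact_biUnion fun σ _ => isCompact_geomSimplex σ

/-- A vertex at which the barycentric coordinate of `x` is largest. -/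
noncomputable def nearestVertex [Nonempty (Fin m)] (x : Fin m → ℝ) : Fin m :=
  (Finite.exists_max x).choose

lemma le_apply_nearestVertex [Nonempty (Fin m)] {σ : Finset (Fin m)} {x : Fin m → ℝ}
    (hx : x ∈ geomSimplex σ) : 1 / (m : ℝ) ≤ x (nearestVertex x) := by
  have hm : 0 < m := Fin.pos_iff_nonempty.2 inferInstance
  have h := Finset.sum_le_card_nsmul Finset.univ x _ fun i _ => (Finite.exists_max x).choose_spec i
  rw [(mem_geomSimplex hx).2, Finset.card_univ, Fintype.card_fin, nsmul_eq_mul] at h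
  rw [div_le_iff₀ (by exact_mod_cast hm), mul_comm]
  exact h

/-- The vertices nearest to points close to `x` lie in every simplex containing `x`. -/
lemma nearestVertex_mem [Nonempty (Fin m)] {σ τ : Finset (Fin m)} {x y : Fin m → ℝ}
    (hx : x ∈ geomSimplex σ) (hy : y ∈ geomSimplex τ) (hxy : dist x y < 1 / (m : ℝ)) :
    nearestVertex y ∈ σ := by
  by_contra h
  have h0 := (mem_geomSimplex hx).1 _ h
  have h1 := le_apply_nearestVertex hy
  have h2 := (dist_le_pi_dist x y (nearestVertex y)).trans_lt hxy
  rw [h0, Real.dist_eq, zero_sub, abs_neg] at h2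
  exact absurd (h1.trans (le_abs_self _)) h2.not_ge

open Classical in
/-- A small chain on `geomSimplex σ` with boundary `c`, if there is one. -/
noncomputable def smallFilling (δ : ℝ) (σ : Finset (Fin m)) (c : OrdChain (Fin m → ℝ)) :
    OrdChain (Fin m → ℝ) :=
  if h : ∃ b ∈ OrdChain.small δ (geomSimplex σ), OrdChain.bd b = c then h.choose else 0

/-- A subdivision of the simplex `σ` into a small chain. -/
noncomputable def subdivide (δ : ℝ) (σ : Finset (Fin m)) : OrdChain (Fin m → ℝ) :=
  if σ = ∅ then Finsupp.single [] 1
  else smallFilling δ σ (∑ v : σ, subdivide δ (σ.erase v))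
termination_by σ.card
decreasing_by exact Finset.card_erase_lt_of_mem v.2

/-- The linear extension of `subdivide`. -/
noncomputable def subdivision (δ : ℝ) :
    FaceChain (Fin m) →ₗ[ZMod 2] OrdChain (Fin m → ℝ) :=
  Finsupp.linearCombination _ (subdivide δ)

lemma subdivision_single (δ : ℝ) (σ : Finset (Fin m)) :
    subdivision δ (Finsupp.single σ 1) = subdivide δ σ := by
  simp [subdivision]

lemma subdivide_empty (δ : ℝ) : subdivide δ (∅ : Finset (Fin m)) = Finsupp.single [] 1 := by
  rw [subdivide, if_pos rfl]

lemma subdivide_spec {δ : ℝ} (hδ : 0 < δ) (σ : Finset (Fin m)) :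
    subdivide δ σ ∈ OrdChain.small δ (geomSimplex σ) ∧
      OrdChain.bd (subdivide δ σ) = subdivision δ (FaceChain.bd (Finsupp.single σ 1)) := by
  induction σ using Finset.strongInduction with
  | H σ ih =>
    rcases σ.eq_empty_or_nonempty with rfl | hne
    · rw [subdivide_empty]
      refine ⟨Finsupp.single_mem_supported _ _ (by simp), ?_⟩
      simp [FaceChain.bd_single, OrdChain.bdList]
    · have hsum : ∑ v : σ, subdivide δ (σ.erase v) =
          subdivision δ (FaceChain.bd (Finsupp.single σ 1)) := by
        rw [FaceChain.bd_single, map_sum, ← Finset.sum_coe_sort σ]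
        exact Finset.sum_congr rfl fun v _ => (subdivision_single _ _).symm
      have hex : ∃ b ∈ OrdChain.small δ (geomSimplex σ),
          OrdChain.bd b = ∑ v : σ, subdivide δ (σ.erase v) := by
        refine OrdChain.exists_bd_eq_of_convex hδ (convex_convexHull ℝ _)
          (isCompact_geomSimplex σ).isBounded ?_ _ (Submodule.sum_mem _ fun v _ => ?_) ?_
        · exact convexHull_nonempty_iff.2 (Set.Nonempty.image _ (Finset.coe_nonempty.2 hne))
        · exact OrdChain.small_mono δ (geomSimplex_mono (Finset.erase_subset _ _))
            (ih _ (Finset.erase_ssubset v.2)).1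
        · rw [map_sum, Finset.sum_congr rfl fun v _ => (ih _ (Finset.erase_ssubset v.2)).2,
            ← map_sum, ← map_sum,
            Finset.sum_coe_sort σ fun v => Finsupp.single (σ.erase v) (1 : ZMod 2),
            ← FaceChain.bd_single, FaceChain.bd_bd, map_zero]
      rw [subdivide, if_neg hne.ne_empty, smallFilling, dif_pos hex, ← hsum]
      exact hex.choose_spec

lemma bd_subdivision {δ : ℝ} (hδ : 0 < δ) (c : FaceChain (Fin m)) :
    OrdChain.bd (subdivision δ c) = subdivision δ (FaceChain.bd c) := by
  have h : OrdChain.bd ∘ₗ subdivision δ = subdivision δ ∘ₗ FaceChain.bd (α := Fin m) := by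
    ext1 σ
    ext1
    simp only [LinearMap.comp_apply, Finsupp.lsingle_apply]
    rw [subdivision_single]
    exact (subdivide_spec hδ σ).2
  exact LinearMap.congr_fun h c

/-- Replacing points by their nearest vertices. -/
noncomputable def toVertices [Nonempty (Fin m)] :
    OrdChain (Fin m → ℝ) →ₗ[ZMod 2] FaceChain (Fin m) :=
  FaceChain.ofOrd ∘ₗ OrdChain.map nearestVertex

lemma bd_toVertices [Nonempty (Fin m)] (c : OrdChain (Fin m → ℝ)) :
    FaceChain.bd (toVertices c) = toVertices (OrdChain.bd c) := by
  rw [toVertices, LinearMap.comp_apply, FaceChain.bd_ofOrd, OrdChain.bd_map, LinearMap.comp_apply]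

lemma toVertices_mem [Nonempty (Fin m)] {δ : ℝ} {Y : Set (Fin m → ℝ)}
    {s : Set (Finset (Fin m))}
    (h : ∀ l : List (Fin m → ℝ), (∀ x ∈ l, x ∈ Y) → (∀ x ∈ l, ∀ y ∈ l, dist x y < δ) →
      (l.map nearestVertex).toFinset ∈ s)
    {c : OrdChain (Fin m → ℝ)} (hc : c ∈ OrdChain.small δ Y) :
    toVertices c ∈ Finsupp.supported (ZMod 2) (ZMod 2) s := by
  refine Finsupp.linearMap_mem_of_mem_supported _ _ (fun l hl => ?_) hc
  rw [toVertices, LinearMap.comp_apply, OrdChain.map_single, FaceChain.ofOrd_single]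
  exact Finsupp.supported_mono (Set.singleton_subset_iff.2 (h l hl.1 hl.2))
    (FaceChain.ofList_mem_supported _)

lemma toVertices_mem_chains [Nonempty (Fin m)] {L : Set (Finset (Fin m))}
    (hL : ∀ σ ∈ insert ∅ L, ∀ τ ⊆ σ, τ ∈ insert ∅ L) {c : OrdChain (Fin m → ℝ)}
    (hc : c ∈ OrdChain.small (1 / (m : ℝ)) (realization L)) :
    toVertices c ∈ FaceChain.chains L := by
  refine toVertices_mem (fun l hl hd => ?_) hc
  have hcarrier : ∀ x ∈ l, ∃ σ ∈ L, x ∈ geomSimplex σ := fun x hx => by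
    simpa [realization, geomSimplex] using hl x hx
  rcases l with _ | ⟨x, l⟩
  · simp
  · obtain ⟨σ, hσ, hxσ⟩ := hcarrier x (by simp)
    refine hL σ (.inr hσ) _ fun v hv => ?_
    obtain ⟨y, hy, rfl⟩ := List.mem_map.1 (List.mem_toFinset.1 hv)
    obtain ⟨τ, _, hyτ⟩ := hcarrier y hy
    exact nearestVertex_mem hxσ hyτ (hd x (by simp) y hy)

lemma subdivision_mem {δ : ℝ} (hδ : 0 < δ) {L : Set (Finset (Fin m))} {c : FaceChain (Fin m)}
    (hc : c ∈ FaceChain.chains L) : subdivision δ c ∈ OrdChain.small δ (realization L) := by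
  refine Finsupp.linearMap_mem_of_mem_supported _ _ (fun σ hσ => ?_) hc
  rw [subdivision_single]
  rcases hσ with rfl | hσ
  · rw [subdivide_empty]
    exact Finsupp.single_mem_supported _ _ (by simp)
  · exact OrdChain.small_mono δ (geomSimplex_subset_realization hσ) (subdivide_spec hδ σ).1

/-- Fine enough cycles in a compact contractible set are boundaries of small chains. -/
lemma exists_bd_eq_of_contractibleSpace {E : Type*} [PseudoMetricSpace E] {X : Set E}
    (hX : IsCompact X) [ContractibleSpace X] {ε : ℝ} (hε : 0 < ε) :
    ∃ δ > 0, ∀ z ∈ OrdChain.small δ X, OrdChain.bd z = 0 →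
      ∃ b ∈ OrdChain.small ε X, OrdChain.bd b = z := by
  classical
  have := isCompact_iff_compactSpace.1 hX
  obtain ⟨c, ⟨H⟩⟩ := id_nullhomotopic X
  obtain ⟨δ, hδ, hH⟩ := Metric.uniformContinuous_iff.1
    (CompactSpace.uniformContinuous_of_continuous H.continuous) ε hε
  refine ⟨δ, hδ, fun z hz hbd => ?_⟩
  obtain ⟨n, hn⟩ := exists_nat_one_div_lt hδ
  have hzl : ∀ l ∈ z.support, (∀ x ∈ l, x ∈ X) ∧ ∀ x ∈ l, ∀ y ∈ l, dist x y < δ :=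
    fun l hl => (Finsupp.mem_supported _ _).1 hz hl
  have hn0 : (0 : ℝ) < n + 1 := by positivity
  let t : ℕ → unitInterval := fun i => Set.projIcc 0 1 zero_le_one (i / (n + 1 : ℝ))
  have ht : ∀ i, dist (t i) (t (i + 1)) < δ := fun i => by
    refine lt_of_le_of_lt ?_ hn
    refine (Set.abs_projIcc_sub_projIcc zero_le_one).trans ?_
    rw [← sub_div, abs_div, abs_of_pos hn0]
    simp
  let f : ℕ → E → E := fun i x => if h : x ∈ X then H (t i, ⟨x, h⟩) else x
  have hf : ∀ i x (h : x ∈ X), f i x = H (t i, ⟨x, h⟩) := fun i x h => dif_pos h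
  refine OrdChain.exists_bd_eq_of_contraction hε f (n + 1) c c.2 z hbd ?_ ?_ ?_ ?_
  · intro l hl x hx i _
    rw [hf i x ((hzl l hl).1 x hx)]
    exact Subtype.coe_prop _
  · intro l hl x hx y hy i _
    have hxy := (hzl l hl).2 x hx y hy
    simp only [hf _ x ((hzl l hl).1 x hx), hf _ y ((hzl l hl).1 y hy)]
    refine ⟨hH ?_, hH ?_, hH ?_⟩ <;> rw [Prod.dist_eq, max_lt_iff]
    · exact ⟨by simpa using hδ, hxy⟩
    · exact ⟨ht i, hxy⟩
    · exact ⟨by simpa using hδ, hxy⟩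
  · intro l hl x hx
    have h0 : t 0 = 0 := by simp [t]
    rw [hf 0 x ((hzl l hl).1 x hx), h0, H.apply_zero]
    rfl
  · intro l hl x hx
    have h1 : t (n + 1) = 1 := by
      have : ((n + 1 : ℕ) / (n + 1 : ℝ)) = 1 := by
        push_cast
        exact div_self hn0.ne'
      simp only [t, this, Set.projIcc_right]
      rfl
    rw [hf _ x ((hzl l hl).1 x hx), h1, H.apply_one]
    rfl

/-- A complex with contractible realization is acyclic. -/
lemma FaceChain.exists_bd_eq_of_contractibleSpace {L : Set (Finset (Fin m))}
    (hL : ∀ σ ∈ insert ∅ L, ∀ τ ⊆ σ, τ ∈ insert ∅ L) [ContractibleSpace (realization L)]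
    {z : FaceChain (Fin m)} (hzL : z ∈ chains L) (hz : bd z = 0) :
    ∃ b ∈ chains L, bd b = z := by
  have hne : Nonempty (Fin m) := by
    obtain ⟨x, hx⟩ := (inferInstance : Nonempty (realization L))
    obtain ⟨σ, -, hσ⟩ := Set.mem_iUnion₂.1 hx
    by_contra h
    rw [not_nonempty_iff] at h
    simpa using (mem_geomSimplex hσ).2
  have hm : (0 : ℝ) < 1 / m := by
    have : 0 < m := Fin.pos_iff_nonempty.2 hne
    positivity
  obtain ⟨δ, hδ, hfill⟩ :=
    _root_.exists_bd_eq_of_contractibleSpace (isCompact_realization L) hm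
  obtain ⟨b, hb, hbz⟩ := hfill (subdivision δ z) (subdivision_mem hδ hzL)
    (by rw [bd_subdivision hδ, hz, map_zero])
  refine exists_bd_eq_of_carried hL (toVertices ∘ₗ subdivision δ) (fun c => ?_) ?_ (fun σ => ?_)
    ⟨toVertices b, toVertices_mem_chains hL hb, ?_⟩
  · simp only [LinearMap.comp_apply, bd_toVertices, bd_subdivision hδ]
  · rw [LinearMap.comp_apply, subdivision_single, subdivide_empty, toVertices,
      LinearMap.comp_apply, OrdChain.map_single, ofOrd_single]
    rfl
  · rw [LinearMap.comp_apply, subdivision_single]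
    refine toVertices_mem (fun l hl _ => ?_) (subdivide_spec hδ σ).1
    intro v hv
    obtain ⟨y, hy, rfl⟩ := List.mem_map.1 (List.mem_toFinset.1 hv)
    exact nearestVertex_mem (hl y hy) (hl y hy) (by rwa [dist_self])
  · rw [bd_toVertices, hbz, LinearMap.comp_apply]

/-- The number of members of a filling in terms of the number of faces and of the dimension of
the space of cycles of the complex. -/
lemma card_filling_add_eq {K : Set (Finset (Fin m))} (hK : IsComplex K)
    {F : Finset (Finset (Fin m))} (hF : IsFilling K F) :
    F.card + (insert ∅ K).ncard =
      2 * Module.finrank (ZMod 2)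
        ((FaceChain.chains K ⊓ LinearMap.ker FaceChain.bd : Submodule (ZMod 2) _)) := by
  obtain ⟨hmin, hcontr⟩ := hF
  set L : Set (Finset (Fin m)) := K ∪ ↑F with hLdef
  have hKsub : ∀ σ ∈ K, ∀ τ ⊆ σ, τ ∈ insert ∅ K := fun σ hσ τ hτ =>
    τ.eq_empty_or_nonempty.imp id (hK.2.1 σ hσ τ hτ)
  have herase : ∀ σ ∈ insert ∅ L, ∀ v ∈ σ, σ.erase v ∈ insert ∅ K := by
    rintro σ (rfl | hσ | hσ) v hv
    · simp at hv
    · exact hKsub σ hσ _ (Finset.erase_subset _ _)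
    · exact .inr ((hmin σ hσ).2.2 v hv)
  have hKL : insert ∅ K ⊆ insert ∅ L := Set.insert_subset_insert Set.subset_union_left
  have hL : ∀ σ ∈ insert ∅ L, ∀ τ ⊆ σ, τ ∈ insert ∅ L := by
    intro σ hσ τ hτ
    rcases hτ.eq_or_ssubset with rfl | hτ
    · exact hσ
    · obtain ⟨v, hv, hvτ⟩ := Finset.exists_of_ssubset hτ
      have hτ' : τ ⊆ σ.erase v := Finset.subset_erase.2 ⟨hτ.subset, hvτ⟩
      rcases herase σ hσ v hv with h | h
      · rw [h, Finset.subset_empty] at hτ'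
        exact .inl hτ'
      · exact hKL (hKsub _ h τ hτ')
  have hcard : (insert ∅ L).ncard = F.card + (insert ∅ K).ncard := by
    have hdisj : Disjoint (insert ∅ K) (F : Set (Finset (Fin m))) := by
      rw [Set.disjoint_right]
      rintro M hM (rfl | hMK)
      · simpa using (hmin _ hM).1
      · exact (hmin M hM).2.1 hMK
    rw [hLdef, ← Set.insert_union, Set.ncard_union_eq hdisj, Set.ncard_coe_finset, add_comm]
  have := Fintype.ofFinite ↑(insert ∅ L)
  have hdim : Module.finrank (ZMod 2) (FaceChain.chains L) = (insert ∅ L).ncard := by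
    rw [FaceChain.chains, (Finsupp.supportedEquivFinsupp (insert ∅ L)).finrank_eq,
      Module.finrank_finsupp_self, Set.ncard_eq_toFinset_card', Set.toFinset_card]
  have hrank := LinearMap.finrank_range_add_finrank_ker (K := ZMod 2) (V := FaceChain.chains L)
    (V₂ := FaceChain (Fin m)) (FaceChain.bd.domRestrict (FaceChain.chains L))
  have hbdL : ∀ c ∈ FaceChain.chains L, FaceChain.bd c ∈ FaceChain.chains K := fun c hc =>
    Finsupp.linearMap_mem_of_mem_supported _ _ (fun σ hσ => by
      rw [FaceChain.bd_single]
      exact Submodule.sum_mem _ fun v hv => Finsupp.single_mem_supported _ _ (herase σ hσ v hv)) hc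
  have hrange : LinearMap.range ((FaceChain.bd (α := Fin m)).domRestrict (FaceChain.chains L)) =
      FaceChain.chains K ⊓ LinearMap.ker FaceChain.bd := by
    ext z
    constructor
    · rintro ⟨⟨c, hc⟩, rfl⟩
      exact ⟨hbdL c hc, FaceChain.bd_bd c⟩
    · rintro ⟨hzK, hz⟩
      obtain ⟨b, hb, rfl⟩ := FaceChain.exists_bd_eq_of_contractibleSpace hL
        (Finsupp.supported_mono hKL hzK) hz
      exact ⟨⟨b, hb⟩, rfl⟩
  have hker : (LinearMap.ker ((FaceChain.bd (α := Fin m)).domRestrict (FaceChain.chains L))).map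
      (FaceChain.chains L).subtype = FaceChain.chains K ⊓ LinearMap.ker FaceChain.bd := by
    ext z
    constructor
    · rintro ⟨⟨c, hc⟩, hcz, rfl⟩
      have hcz : FaceChain.bd c = 0 := hcz
      obtain ⟨b, hb, rfl⟩ := FaceChain.exists_bd_eq_of_contractibleSpace hL hc hcz
      exact ⟨hbdL b hb, hcz⟩
    · rintro ⟨hzK, hz⟩
      exact ⟨⟨z, Finsupp.supported_mono hKL hzK⟩, hz, rfl⟩
  rw [← hcard, ← hdim, ← hrank, ← hrange, two_mul]
  congr 1
  rw [hrange, ← hker, Submodule.finrank_map_subtype_eq]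

end Realization

/-- Any two fillings of a simplicial complex have the same number of members. -/
theorem filling_card_eq {m : ℕ} (K : Set (Finset (Fin m))) (hK : IsComplex K)
    (F G : Finset (Finset (Fin m))) (hF : IsFilling K F) (hG : IsFilling K G) :
    F.card = G.card := by
  have h := (card_filling_add_eq hK hF).trans (card_filling_add_eq hK hG).symm
  omega
end

section
/- For every m ≥ 2 and every k with 0 ≤ k ≤ m − 2, the k-skeleton of the simplex on the vertex set [m] (the simplicial complex whose faces are the nonempty subsets of [m] with at most k + 1 elements) is fillable: there exist pairwise distinct minimal non-faces M_1,…,M_r of this complex (each a (k+2)-element subset of [m]) such that the geometric realization of the complex obtained by adding M_1,…,M_r as faces is contractible. -/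
/-- If every face stays a face after adjoining the vertex `v`, then the realization is
star-shaped about the corresponding basis vector. -/
theorem starConvex_realization {m : ℕ} {K : Set (Finset (Fin m))} (v : Fin m)
    (hK : ∀ σ ∈ K, insert v σ ∈ K) :
    StarConvex ℝ (stdBasisVec m v) (realization K) := by
  rw [starConvex_iff_segment_subset]
  intro x hx
  simp only [realization, Set.mem_iUnion, exists_prop] at hx
  obtain ⟨σ, hσ, hx⟩ := hx
  refine Set.Subset.trans ?_ (Set.subset_biUnion_of_mem (hK σ hσ))
  refine (convex_convexHull ℝ _).segment_subset ?_ ?_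
  · exact subset_convexHull ℝ _ ⟨v, by simp, rfl⟩
  · exact convexHull_mono (Set.image_mono (by simp)) hx

/-- The `k`-skeleton of the simplex on `[m]` is fillable, with a filling consisting
of minimal non-faces of cardinality `k + 2`. -/
theorem skeleton_of_simplex_fillable (m k : ℕ) (hm : 2 ≤ m) (hk : k ≤ m - 2) :
    ∃ F : Finset (Finset (Fin m)),
      IsFilling {σ : Finset (Fin m) | σ.Nonempty ∧ σ.card ≤ k + 1} F ∧
      ∀ M ∈ F, M.card = k + 2 := by
  let v : Fin m := ⟨0, by omega⟩
  refine ⟨Finset.univ.filter fun M => v ∈ M ∧ M.card = k + 2, ⟨?_, ?_⟩, by simp⟩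
  · intro M hM
    obtain ⟨-, -, hc⟩ := Finset.mem_filter.1 hM
    refine ⟨by omega, fun h => ?_, fun w hw => ⟨?_, ?_⟩⟩
    · have := h.2
      omega
    · rw [← Finset.card_pos, Finset.card_erase_of_mem hw]
      omega
    · rw [Finset.card_erase_of_mem hw]
      omega
  · refine (starConvex_realization v ?_).contractibleSpace ?_
    · intro σ hσ
      simp only [Set.mem_union, Set.mem_ofPred_eq, Finset.coe_filter, Finset.mem_univ,
        true_and, Finset.insert_nonempty, Finset.mem_insert_self] at hσ ⊢
      by_cases hv : v ∈ σ
      · rw [Finset.insert_eq_of_mem hv]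
        tauto
      · rw [Finset.card_insert_of_notMem hv]
        have : σ.card ≤ k + 1 := by tauto
        omega
    · refine ⟨stdBasisVec m v, Set.mem_biUnion (x := {v}) (Or.inl ⟨by simp, by simp⟩) ?_⟩
      exact subset_convexHull ℝ _ ⟨v, by simp, rfl⟩
end

section
/- Let K be the complete 1-skeleton on [6] = {1,…,6} (the simplicial complex whose faces are all subsets of [6] with at most 2 elements, nonempty), and let F = {{1,2,4},{1,2,6},{1,3,4},{1,3,5},{1,5,6},{2,3,5},{2,3,6},{2,4,5},{3,4,6},{4,5,6}} be the set of 2-faces of the 6-vertex triangulation of the real projective plane. Then for every σ ∈ F, the geometric realization of the simplicial complex whose faces are those of K together with the ten triangles (F ∖ {σ}) ∪ {{1,2,3}} is contractible; in particular, (F ∖ {σ}) ∪ {{1,2,3}} is a pure filling of K and K is fillable. -/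
/-- The complete 1-skeleton on `[6]`: all nonempty subsets with at most 2 elements.
(Vertices `1, …, 6` of `[6]` are represented by `0, …, 5 : Fin 6`.) -/
def K6 : Set (Finset (Fin 6)) := {σ | σ.Nonempty ∧ σ.card ≤ 2}

/-- The ten 2-faces of the 6-vertex triangulation of `ℝP²` (0-indexed), i.e.
`{1,2,4}, {1,2,6}, {1,3,4}, {1,3,5}, {1,5,6}, {2,3,5}, {2,3,6}, {2,4,5}, {3,4,6}, {4,5,6}`. -/
def rp2Faces : Finset (Finset (Fin 6)) :=
  {{0, 1, 3}, {0, 1, 5}, {0, 2, 3}, {0, 2, 4}, {0, 4, 5},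
   {1, 2, 4}, {1, 2, 5}, {1, 3, 4}, {2, 3, 5}, {3, 4, 5}}

/-- A family of finite sets is closed under passing to nonempty subsets. -/
def IsDownClosed {m : ℕ} (K : Set (Finset (Fin m))) : Prop :=
  ∀ σ ∈ K, ∀ τ ⊆ σ, τ.Nonempty → τ ∈ K

theorem mem_convexHull_stdBasisVec_iff {m : ℕ} (σ : Finset (Fin m)) (x : Fin m → ℝ) :
    x ∈ convexHull ℝ (stdBasisVec m '' (σ : Set (Fin m))) ↔
      (∀ i, 0 ≤ x i) ∧ ∑ i, x i = 1 ∧ ∀ i ∉ σ, x i = 0 := by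
  constructor
  · intro hx
    have hconv : Convex ℝ {x : Fin m → ℝ |
        (∀ i, 0 ≤ x i) ∧ ∑ i, x i = 1 ∧ ∀ i ∉ σ, x i = 0} := by
      rintro x ⟨hx0, hx1, hxσ⟩ y ⟨hy0, hy1, hyσ⟩ a b ha hb hab
      refine ⟨fun i => ?_, ?_, fun i hi => ?_⟩
      · have := hx0 i
        have := hy0 i
        simp only [Pi.add_apply, Pi.smul_apply, smul_eq_mul]
        positivity
      · simp [Finset.sum_add_distrib, ← Finset.mul_sum, hx1, hy1, hab]
      · simp [hxσ i hi, hyσ i hi]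
    refine convexHull_min ?_ hconv hx
    rintro _ ⟨i, hi, rfl⟩
    refine ⟨fun j => ?_, by simp [stdBasisVec], fun j hj => ?_⟩
    · simp only [stdBasisVec]
      split_ifs <;> norm_num
    · simp only [stdBasisVec, ite_eq_right_iff]
      rintro rfl
      exact absurd hi hj
  · rintro ⟨hx0, hx1, hxσ⟩
    have hsum : ∑ i ∈ σ, x i = 1 := by
      rw [← hx1]
      exact Finset.sum_subset (Finset.subset_univ _) fun i _ hi => hxσ i hi
    have hx : x = ∑ i ∈ σ, x i • stdBasisVec m i := by
      ext j
      simp only [Finset.sum_apply, Pi.smul_apply, stdBasisVec, smul_eq_mul, mul_ite, mul_one,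
        mul_zero, Finset.sum_ite_eq]
      split_ifs with hj
      · rfl
      · exact hxσ j hj
    rw [hx]
    exact (convex_convexHull ℝ _).sum_mem (fun i _ => hx0 i) hsum fun i hi =>
      subset_convexHull ℝ _ ⟨i, hi, rfl⟩

theorem mem_realization_iff {m : ℕ} (K : Set (Finset (Fin m))) (x : Fin m → ℝ) :
    x ∈ realization K ↔
      ∃ σ ∈ K, (∀ i, 0 ≤ x i) ∧ ∑ i, x i = 1 ∧ ∀ i ∉ σ, x i = 0 := by
  simp only [realization, Set.mem_iUnion, mem_convexHull_stdBasisVec_iff, exists_prop]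

/-- A set that deforms onto a contractible subset is contractible. -/
theorem contractibleSpace_of_deformation {E : Type*} [TopologicalSpace E] {A X : Set E}
    (hAX : A ⊆ X) (H : ℝ → E → E) (hH : Continuous fun p : ℝ × E => H p.1 p.2)
    (hHX : ∀ t ∈ Set.Icc (0 : ℝ) 1, ∀ x ∈ X, H t x ∈ X) (hH0 : ∀ x ∈ X, H 0 x = x)
    (hH1 : ∀ x ∈ X, H 1 x ∈ A) (hHA : ∀ x ∈ A, H 1 x = x) [ContractibleSpace A] :
    ContractibleSpace X := by
  have hH1c : Continuous (H 1) := hH.comp (by fun_prop : Continuous fun x : E => ((1 : ℝ), x))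
  let r : C(X, A) := ⟨fun x => ⟨H 1 x, hH1 x x.2⟩, by fun_prop⟩
  let ι : C(A, X) := ⟨Set.inclusion hAX, continuous_inclusion hAX⟩
  have hright : r.comp ι = ContinuousMap.id A := by
    ext x
    exact hHA x x.2
  let h : ContinuousMap.Homotopy (ContinuousMap.id X) (ι.comp r) :=
    { toFun := fun p => ⟨H p.1 p.2, hHX _ p.1.2 _ p.2.2⟩
      continuous_toFun := (hH.comp (by fun_prop : Continuous fun p : unitInterval × X =>
        ((p.1 : ℝ), (p.2 : E)))).subtype_mk _
      map_zero_left := fun x => Subtype.ext (hH0 x x.2)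
      map_one_left := fun x => rfl }
  let e : ContinuousMap.HomotopyEquiv X A :=
    { toFun := r
      invFun := ι
      left_inv := ⟨h.symm⟩
      right_inv := hright ▸ ContinuousMap.Homotopic.refl _ }
  exact e.contractibleSpace

/-- If every face containing `τ` stays a face after adding the vertex `v ∉ τ`, then removing all
faces that contain `τ` does not destroy contractibility: push every point away from `τ`
towards `v`. -/
theorem contractibleSpace_realization_of_collapse {m : ℕ} {K : Set (Finset (Fin m))}
    (hK : IsDownClosed K) {τ : Finset (Fin m)} (hτ : τ.Nonempty) {v : Fin m} (hv : v ∉ τ)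
    (hcone : ∀ ρ ∈ K, τ ⊆ ρ → insert v ρ ∈ K)
    [ContractibleSpace (realization {ρ ∈ K | ¬ τ ⊆ ρ})] :
    ContractibleSpace (realization K) := by
  let μ : (Fin m → ℝ) → ℝ := fun x => τ.inf' hτ x
  let w : Fin m → ℝ := fun i => if i ∈ τ then -1 else if i = v then τ.card else 0
  have hμc : Continuous μ := Continuous.finset_inf'_apply hτ fun i _ => continuous_apply i
  have hw : ∑ i, w i = 0 := by
    have hw' : ∀ i, w i = (if i ∈ τ then -1 else 0) + if i = v then (τ.card : ℝ) else 0 := by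
      intro i
      by_cases hi : i ∈ τ
      · have : i ≠ v := fun h => hv (h ▸ hi)
        simp [w, hi, this]
      · simp [w, hi]
    simp [hw', Finset.sum_add_distrib]
  have hwv : ∀ i, i ∉ τ → 0 ≤ w i := by
    intro i hi
    simp only [w, hi, if_false]
    split_ifs <;> positivity
  have hw0 : ∀ i, i ∉ τ → i ≠ v → w i = 0 := fun i hi hiv => by simp [w, hi, hiv]
  have hwτ : ∀ i ∈ τ, w i = -1 := fun i hi => by simp [w, hi]
  have hμ0 : ∀ x : Fin m → ℝ, (∀ i, 0 ≤ x i) → 0 ≤ μ x := fun x hx =>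
    Finset.le_inf' _ _ fun i _ => hx i
  have hμle : ∀ x : Fin m → ℝ, ∀ i ∈ τ, μ x ≤ x i := fun x i hi => Finset.inf'_le _ hi
  have hμeq : ∀ x : Fin m → ℝ, ∀ σ : Finset (Fin m), (∀ i, 0 ≤ x i) → (∀ i ∉ σ, x i = 0) →
      ¬ τ ⊆ σ → μ x = 0 := by
    intro x σ hx hxσ hσ
    obtain ⟨i, hi, hiσ⟩ := Finset.not_subset.1 hσ
    exact le_antisymm (hxσ i hiσ ▸ hμle x i hi) (hμ0 x hx)
  have hnonneg : ∀ t ∈ Set.Icc (0 : ℝ) 1, ∀ x : Fin m → ℝ, (∀ i, 0 ≤ x i) →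
      ∀ i, 0 ≤ x i + t * μ x * w i := by
    intro t ht x hx i
    have h0 := hμ0 x hx
    by_cases hi : i ∈ τ
    · have h1 := hμle x i hi
      rw [hwτ i hi]
      nlinarith [mul_le_mul_of_nonneg_right ht.2 h0]
    · exact add_nonneg (hx i) (mul_nonneg (mul_nonneg ht.1 h0) (hwv i hi))
  have hsum : ∀ t : ℝ, ∀ x : Fin m → ℝ, ∑ i, x i = 1 → ∑ i, (x i + t * μ x * w i) = 1 := by
    intro t x hx
    rw [Finset.sum_add_distrib, ← Finset.mul_sum, hw, hx, mul_zero, add_zero]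
  have hsupp : ∀ t : ℝ, ∀ x : Fin m → ℝ, ∀ σ : Finset (Fin m), τ ⊆ σ → (∀ i ∉ σ, x i = 0) →
      ∀ i ∉ insert v σ, x i + t * μ x * w i = 0 := by
    intro t x σ hσ hxσ i hi
    rw [Finset.mem_insert, not_or] at hi
    rw [hxσ i hi.2, hw0 i (fun h => hi.2 (hσ h)) hi.1, mul_zero, add_zero]
  refine contractibleSpace_of_deformation (A := realization {ρ ∈ K | ¬ τ ⊆ ρ})
    (fun x hx => ?_) (fun t x i => x i + t * μ x * w i) (by fun_prop) ?_ ?_ ?_ ?_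
  · rw [mem_realization_iff] at hx ⊢
    obtain ⟨σ, hσ, h⟩ := hx
    exact ⟨σ, hσ.1, h⟩
  · intro t ht x hx
    rw [mem_realization_iff] at hx ⊢
    obtain ⟨σ, hσ, hx0, hx1, hxσ⟩ := hx
    by_cases hτσ : τ ⊆ σ
    · exact ⟨insert v σ, hcone σ hσ hτσ, hnonneg t ht x hx0, hsum t x hx1,
        hsupp t x σ hτσ hxσ⟩
    · refine ⟨σ, hσ, ?_⟩
      simpa [hμeq x σ hx0 hxσ hτσ] using ⟨hx0, hx1, hxσ⟩
  · intro x _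
    simp
  · intro x hx
    rw [mem_realization_iff] at hx ⊢
    obtain ⟨σ, hσ, hx0, hx1, hxσ⟩ := hx
    by_cases hτσ : τ ⊆ σ
    · obtain ⟨u, hu, hμu⟩ := Finset.exists_mem_eq_inf' hτ x
      have huv : v ≠ u := fun h => hv (h ▸ hu)
      refine ⟨(insert v σ).erase u, ⟨hK _ (hcone σ hσ hτσ) _ (Finset.erase_subset _ _)
        ⟨v, by simp [huv]⟩, fun h => Finset.notMem_erase u _ (h hu)⟩,
        hnonneg 1 (by simp) x hx0, hsum 1 x hx1, fun i hi => ?_⟩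
      by_cases hiu : i = u
      · subst hiu
        have : μ x = x i := hμu
        simp [hwτ i hu, this]
      · exact hsupp 1 x σ hτσ hxσ i fun h => hi (Finset.mem_erase.2 ⟨hiu, h⟩)
    · refine ⟨σ, ⟨hσ, hτσ⟩, ?_⟩
      simpa [hμeq x σ hx0 hxσ hτσ] using ⟨hx0, hx1, hxσ⟩
  · intro x hx
    rw [mem_realization_iff] at hx
    obtain ⟨σ, hσ, hx0, -, hxσ⟩ := hx
    ext i
    simp [hμeq x σ hx0 hxσ hσ.2]

/-- Remove all faces containing `τ` if they form a cone over a vertex outside `τ`. -/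
def collapseStep {m : ℕ} (K : Finset (Finset (Fin m))) (τ : Finset (Fin m)) :
    Finset (Finset (Fin m)) :=
  if τ.Nonempty ∧ ∃ v ∉ τ, ∀ ρ ∈ K, τ ⊆ ρ → insert v ρ ∈ K then
    K.filter fun ρ => ¬ τ ⊆ ρ
  else K

theorem contractibleSpace_of_foldl_collapseStep {m : ℕ} (L : List (Finset (Fin m)))
    {K : Finset (Finset (Fin m))} (hK : IsDownClosed (K : Set (Finset (Fin m)))) {v : Fin m}
    (h : L.foldl collapseStep K = {{v}}) :
    ContractibleSpace (realization (K : Set (Finset (Fin m)))) := by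
  induction L generalizing K with
  | nil =>
    rw [List.foldl_nil] at h
    subst h
    refine Convex.contractibleSpace ?_ ?_ <;> simp [realization]
  | cons τ L ih =>
    rw [List.foldl_cons] at h
    by_cases hstep : τ.Nonempty ∧ ∃ v ∉ τ, ∀ ρ ∈ K, τ ⊆ ρ → insert v ρ ∈ K
    · obtain ⟨hτ, u, hu, hcone⟩ := id hstep
      rw [collapseStep, if_pos hstep] at h
      have hcontr := ih (fun σ hσ ρ hρ hne => by
        simp only [Finset.coe_filter, Set.mem_ofPred_eq] at hσ ⊢
        exact ⟨hK σ hσ.1 ρ hρ hne, fun hτρ => hσ.2 (hτρ.trans hρ)⟩) h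
      rw [Finset.coe_filter] at hcontr
      exact contractibleSpace_realization_of_collapse hK hτ hu hcone
    · rw [collapseStep, if_neg hstep] at h
      exact ih hK h

/-- The complete 1-skeleton `K6` as a finset. -/
def K6Finset : Finset (Finset (Fin 6)) :=
  Finset.powersetCard 1 Finset.univ ∪ Finset.powersetCard 2 Finset.univ

theorem coe_K6Finset : (K6Finset : Set (Finset (Fin 6))) = K6 := by
  ext σ
  simp only [K6Finset, K6, Finset.coe_union, Set.mem_union, Finset.mem_coe,
    Finset.mem_powersetCard_univ, Set.mem_ofPred_eq, ← Finset.card_pos]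
  omega

theorem isDownClosed_K6_union {G : Set (Finset (Fin 6))} (hG : ∀ M ∈ G, M.card = 3) :
    IsDownClosed (K6 ∪ G) := by
  intro σ hσ τ hτσ hτ
  have hle := Finset.card_le_card hτσ
  rcases hσ with hσ | hσ
  · exact Or.inl ⟨hτ, hle.trans hσ.2⟩
  · rcases hτσ.eq_or_ssubset with rfl | hlt
    · exact Or.inr hσ
    · have := Finset.card_lt_card hlt
      have := hG σ hσ
      exact Or.inl ⟨hτ, by omega⟩

theorem isMinNonFace_K6 {M : Finset (Fin 6)} (hM : M.card = 3) : IsMinNonFace K6 M := by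
  refine ⟨by omega, fun h => ?_, fun v hv => ?_⟩
  · have := h.2
    omega
  · have := Finset.card_erase_of_mem hv
    exact ⟨Finset.card_pos.1 (by omega), by omega⟩

/-- A sequence of collapses that works for all ten fillings at once. -/
def rp2Collapses : List (Finset (Fin 6)) :=
  [{0, 4}, {1, 5}, {2, 3}, {1, 4}, {4, 5}, {2, 5}, {3, 5}, {1, 3}, {3, 4}, {1, 4},
    {4}, {3}, {5}, {2}, {1}]

theorem foldl_collapseStep_rp2 : ∀ σ ∈ rp2Faces,
    rp2Collapses.foldl collapseStep
      (K6Finset ∪ insert ({0, 1, 2} : Finset (Fin 6)) (rp2Faces.erase σ)) = {{0}} := by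
  decide +kernel

theorem card_of_mem_rp2_filling {σ M : Finset (Fin 6)}
    (hM : M ∈ insert ({0, 1, 2} : Finset (Fin 6)) (rp2Faces.erase σ)) : M.card = 3 := by
  have h : ∀ M ∈ insert ({0, 1, 2} : Finset (Fin 6)) rp2Faces, M.card = 3 := by decide +kernel
  exact h M (Finset.insert_subset_insert _ (Finset.erase_subset _ _) hM)

theorem contractibleSpace_rp2_filling {σ : Finset (Fin 6)} (hσ : σ ∈ rp2Faces) :
    ContractibleSpace (realization
      (K6 ∪ ↑(insert ({0, 1, 2} : Finset (Fin 6)) (rp2Faces.erase σ)))) := by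
  have hcl := isDownClosed_K6_union
    (G := ↑(insert ({0, 1, 2} : Finset (Fin 6)) (rp2Faces.erase σ)))
    fun M hM => card_of_mem_rp2_filling hM
  rw [← coe_K6Finset, ← Finset.coe_union] at hcl ⊢
  exact contractibleSpace_of_foldl_collapseStep rp2Collapses hcl (foldl_collapseStep_rp2 σ hσ)

theorem isFilling_rp2 {σ : Finset (Fin 6)} (hσ : σ ∈ rp2Faces) :
    IsFilling K6 (insert ({0, 1, 2} : Finset (Fin 6)) (rp2Faces.erase σ)) :=
  ⟨fun _ hM => isMinNonFace_K6 (card_of_mem_rp2_filling hM), contractibleSpace_rp2_filling hσ⟩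

/-- For every `σ ∈ rp2Faces`, replacing `σ` by the triangle `{1,2,3}` in `rp2Faces`
yields a pure filling of the complete 1-skeleton `K6`; in particular `K6` is fillable. -/
theorem rp2_fillings :
    (∀ σ ∈ rp2Faces,
      ContractibleSpace (realization
        (K6 ∪ ↑(insert ({0, 1, 2} : Finset (Fin 6)) (rp2Faces.erase σ)))) ∧
      IsFilling K6 (insert ({0, 1, 2} : Finset (Fin 6)) (rp2Faces.erase σ)) ∧
      ∀ M ∈ insert ({0, 1, 2} : Finset (Fin 6)) (rp2Faces.erase σ), M.card = 3) ∧
    ∃ F : Finset (Finset (Fin 6)), IsFilling K6 F := by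
  exact ⟨fun σ hσ => ⟨contractibleSpace_rp2_filling hσ, isFilling_rp2 hσ,
    fun _ hM => card_of_mem_rp2_filling hM⟩,
    _, isFilling_rp2 (σ := {0, 1, 3}) (by simp [rp2Faces])⟩
end
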